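/- Let n ∈ ℕ be such that there exists a balanced tree T of size n (number of non-root nodes) of height h with degree sequence (0, 1, 2, 4, d_{h−4}, …, d_0) satisfying d_{i+1} < d_i ≤ 2·d_{i+1} + 1 for every i ≤ h − 4. Then T is stable and SC(T) ≤ 2.83 · n; in particular, for all such n the Price of Stability of the tree connection game is at most 2.83. -/

import Mathlib

open Function
open scoped ENNReal Classical

noncomputable section

namespace TCG

variable {n : ℕ}

/-- In-degree of node `v` in the network induced by profile `s` with root `r`:
the number of activated edges `(u, v)` with `u` an agent (a non-root node). -/
def indeg (r : Fin (n + 1)) (s : Fin (n + 1) → Fin (n + 1)) (v : Fin (n + 1)) : ℕ :=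
  Nat.card {u : Fin (n + 1) | u ≠ r ∧ s u = v}

/-- `|T(u)|`: the number of nodes having a directed path to `u` (including `u` itself). -/
def subtreeSize (s : Fin (n + 1) → Fin (n + 1)) (u : Fin (n + 1)) : ℕ :=
  Nat.card {w : Fin (n + 1) | ∃ k, s^[k] w = u}

/-- Cost of the agent at node `v` with respect to the root `r`:
the sum, over the edges `(u, u')` of the unique directed path from `v` to `r`,
of `indeg(u') / |T(u)|`; the cost is `∞` if no such path exists. -/
def cost (r : Fin (n + 1)) (s : Fin (n + 1) → Fin (n + 1)) (v : Fin (n + 1)) : ℝ≥0∞ :=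
  if h : ∃ k, s^[k] v = r then
    ∑ k ∈ Finset.range (Nat.find h),
      (indeg r s (s^[k + 1] v) : ℝ≥0∞) / (subtreeSize s (s^[k] v) : ℝ≥0∞)
  else ⊤

/-- A valid strategy profile: the root is absorbing (a formal convention encoding that the
root activates no edge), and every agent chooses a node different from herself. -/
def ValidProfile (r : Fin (n + 1)) (s : Fin (n + 1) → Fin (n + 1)) : Prop :=
  s r = r ∧ ∀ v, v ≠ r → s v ≠ v

/-- Pure Nash equilibrium (the induced network is *stable*): no agent can strictly
decrease her cost by unilaterally switching her activated edge to another node. -/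
def IsStable (r : Fin (n + 1)) (s : Fin (n + 1) → Fin (n + 1)) : Prop :=
  ValidProfile r s ∧
    ∀ v, v ≠ r → ∀ w, w ≠ v → cost r s v ≤ cost r (Function.update s v w) v

/-- Social cost: the sum of the costs of all agents (the non-root nodes). -/
def SC (s : Fin (n + 1) → Fin (n + 1)) : ℝ≥0∞ :=
  ∑ v ∈ Finset.univ.erase (0 : Fin (n + 1)), cost 0 s v

/-- Height of the induced network: the maximum length of a (leaf-to-)root path,
i.e. the least `k` such that every node arrives at the root after `k` steps. -/
def height (s : Fin (n + 1) → Fin (n + 1)) : ℕ :=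
  sInf {k | ∀ v, s^[k] v = 0}

/-- Fairness Ratio: maximum agent cost divided by minimum agent cost. -/
def FR (s : Fin (n + 1) → Fin (n + 1)) : ℝ≥0∞ :=
  (⨆ (v : Fin (n + 1)) (_ : v ≠ 0), cost 0 s v) /
    (⨅ (v : Fin (n + 1)) (_ : v ≠ 0), cost 0 s v)

/-- Degrees `d` and subtree sizes `N`, indexed by the distance from the root, of a balanced tree of
height `H + 3` whose degree sequence ends in `4, 2, 1, 0`. -/
structure BalancedSeq (H : ℕ) (d N : ℕ → ℝ) : Prop where
  d_add_three : d (H + 3) = 0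
  d_add_two : d (H + 2) = 1
  d_add_one : d (H + 1) = 2
  d_self : d H = 4
  succ_add_one_le : ∀ i < H + 3, d (i + 1) + 1 ≤ d i
  le_two_mul : ∀ i < H + 3, d i ≤ 2 * d (i + 1) + 1
  N_add_three : N (H + 3) = 1
  N_rec : ∀ i < H + 3, N i = 1 + d i * N (i + 1)

/-- The cost of an agent at distance `k` from the root. -/
def levelCost (d N : ℕ → ℝ) (k : ℕ) : ℝ :=
  ∑ i ∈ Finset.range k, d i / N (i + 1)

/-- Up to the common summand `1 / N k`, the cost of reaching a node at level `l` for an agent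
at level `k` that attaches to a node at level `m` below it. -/
def deviationCost (d N : ℕ → ℝ) (l k m : ℕ) : ℝ :=
  d m / N k + ∑ i ∈ Finset.Ico l m, d i / (N (i + 1) + N k)

/-- The sum of squares of the degrees in a subtree of a balanced tree, by levels counted from the
leaves. -/
def sqDegSum (h : ℕ) (d : ℕ → ℝ) : ℕ → ℝ
  | 0 => 0
  | i + 1 => d (h - (i + 1)) * (d (h - (i + 1)) + sqDegSum h d i)

namespace BalancedSeq

variable {H : ℕ} {d N : ℕ → ℝ} (B : BalancedSeq H d N)
include B

lemma d_anti {i j : ℕ} (hij : i ≤ j) (hj : j ≤ H + 3) : d j ≤ d i := by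
  induction j, hij using Nat.le_induction with
  | base => exact le_rfl
  | succ j _ ih => linarith [ih (by omega), B.succ_add_one_le j (by omega)]

lemma d_nonneg {i : ℕ} (hi : i ≤ H + 3) : 0 ≤ d i := by
  simpa [B.d_add_three] using B.d_anti hi le_rfl

lemma one_le_d {i : ℕ} (hi : i < H + 3) : 1 ≤ d i := by
  linarith [B.succ_add_one_le i hi, B.d_nonneg (i := i + 1) (by omega)]

lemma four_le_d {i : ℕ} (hi : i ≤ H) : 4 ≤ d i := by
  simpa [B.d_self] using B.d_anti hi (by omega)

lemma one_le_N {i : ℕ} (hi : i ≤ H + 3) : 1 ≤ N i := by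
  induction hi using Nat.decreasingInduction with
  | self => exact B.N_add_three.ge
  | of_succ k hk ih =>
    rw [B.N_rec k (by omega)]
    nlinarith [B.d_nonneg (i := k) (by omega)]

lemma N_pos {i : ℕ} (hi : i ≤ H + 3) : 0 < N i := by
  linarith [B.one_le_N hi]

lemma N_anti {i j : ℕ} (hij : i ≤ j) (hj : j ≤ H + 3) : N j ≤ N i := by
  induction j, hij using Nat.le_induction with
  | base => exact le_rfl
  | succ j _ ih =>
    have h1 := B.N_rec j (by omega)
    have h2 := B.one_le_d (i := j) (by omega)
    have h3 := B.N_pos hj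
    nlinarith [ih (by omega)]

lemma N_add_two : N (H + 2) = 2 := by
  rw [B.N_rec _ (by omega), B.N_add_three, B.d_add_two]; norm_num

lemma N_add_one : N (H + 1) = 5 := by
  rw [B.N_rec _ (by omega), B.N_add_two, B.d_add_one]; norm_num

lemma N_self : N H = 21 := by
  rw [B.N_rec _ (by omega), B.N_add_one, B.d_self]; norm_num

lemma levelCost_nonneg {k : ℕ} (hk : k ≤ H + 3) : 0 ≤ levelCost d N k := by
  refine Finset.sum_nonneg fun i hi => ?_
  have hi := Finset.mem_range.1 hi
  exact div_nonneg (B.d_nonneg (by omega)) (B.N_pos (by omega)).le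

lemma sum_d_div_N_sq_le {q : ℕ} (hq : q ≤ H) :
    ∑ i ∈ Finset.range q, d i / N (i + 1) ^ 2 ≤ 12 / 5 / (N (q + 1) * N q) := by
  induction q with
  | zero =>
    have h1 := B.N_pos (i := 1) (by omega)
    have h0 := B.N_pos (i := 0) (by omega)
    simp only [Finset.range_zero, Finset.sum_empty]
    positivity
  | succ q ih =>
    rw [Finset.sum_range_succ]
    have hx := B.N_pos (i := q + 1 + 1) (by omega)
    have hy := B.N_pos (i := q + 1) (by omega)
    have hz := B.N_pos (i := q) (by omega)
    have e1 := B.N_rec q (by omega)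
    have e2 := B.N_rec (q + 1) (by omega)
    have d1 := B.four_le_d hq
    have d2 := B.succ_add_one_le q (by omega)
    have d3 := B.le_two_mul q (by omega)
    have h1 : 12 / 5 / (N (q + 1) * N q) ≤ 3 / 25 / (N (q + 1 + 1) * N (q + 1)) := by
      rw [div_le_div_iff₀ (by positivity) (by positivity)]
      have a : 5 * N (q + 1) ≤ N q := by nlinarith
      have b : 4 * N (q + 1 + 1) ≤ N (q + 1) := by nlinarith
      have : 20 * N (q + 1 + 1) ≤ N q := by linarith
      nlinarith
    have h2 : d q / N (q + 1) ^ 2 ≤ 9 / 4 / (N (q + 1 + 1) * N (q + 1)) := by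
      rw [div_le_div_iff₀ (by positivity) (by positivity)]
      have : d q * N (q + 1 + 1) ≤ 9 / 4 * N (q + 1) := by nlinarith
      nlinarith
    have h3 : 3 / 25 / (N (q + 1 + 1) * N (q + 1)) + 9 / 4 / (N (q + 1 + 1) * N (q + 1))
        ≤ 12 / 5 / (N (q + 1 + 1) * N (q + 1)) := by
      rw [← add_div]
      gcongr
      norm_num
    linarith [ih (by omega)]

lemma saving_le {q : ℕ} (hq : q ≤ H) {x : ℝ} (hx : 0 < x) :
    ∑ i ∈ Finset.range q, (d i / N (i + 1) - d i / (N (i + 1) + x))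
      ≤ x * (12 / 5 / (N (q + 1) * N q)) := by
  refine le_trans ?_ (mul_le_mul_of_nonneg_left (B.sum_d_div_N_sq_le hq) hx.le)
  rw [Finset.mul_sum]
  refine Finset.sum_le_sum fun i hi => ?_
  have hi := Finset.mem_range.1 hi
  have hN := B.N_pos (i := i + 1) (by omega)
  have hd := B.d_nonneg (i := i) (by omega)
  have : d i / N (i + 1) - d i / (N (i + 1) + x) = x * (d i / (N (i + 1) * (N (i + 1) + x))) := by
    field_simp
    ring
  rw [this]
  gcongr
  nlinarith

/-- Attaching to a node next to the parent instead of the parent saves less than it adds. -/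
lemma total_saving_le {k : ℕ} (hk : k + 1 ≤ H + 3) :
    ∑ i ∈ Finset.range k, (d i / N (i + 1) - d i / (N (i + 1) + N (k + 1)))
      ≤ min 1 (1 + d (k + 1) - d k / 2) / N (k + 1) ∧
    (k = H + 1 → ∑ i ∈ Finset.range k, (d i / N (i + 1) - d i / (N (i + 1) + N (k + 1)))
      ≤ 1 / 3) := by
  have hT := B.saving_le le_rfl (B.N_pos hk)
  rw [B.N_self, B.N_add_one] at hT
  have e0 := B.N_self
  have e1 := B.N_add_one
  have e2 := B.N_add_two
  have e3 := B.N_add_three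
  have d0 := B.d_self
  have d1 := B.d_add_one
  have d2 := B.d_add_two
  have d3 := B.d_add_three
  obtain hk' | rfl | rfl : k ≤ H ∨ k = H + 1 ∨ k = H + 2 := by omega
  · refine ⟨?_, by omega⟩
    have hx := B.N_pos hk
    have hz := B.N_pos (i := k) (by omega)
    refine (B.saving_le hk' hx).trans ?_
    have hd := B.four_le_d hk'
    have hr := B.N_rec k (by omega)
    have hu := B.le_two_mul k (by omega)
    have hmin : 12 / 5 / d k ≤ min 1 (1 + d (k + 1) - d k / 2) := by
      refine le_min ?_ ?_
      · rw [div_le_one (by linarith)]; linarith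
      · obtain rfl | h' := hk'.eq_or_lt
        · rw [d0, d1]; norm_num
        · have := B.succ_add_one_le k (by omega)
          have h4 := B.four_le_d (i := k + 1) (by omega)
          rw [div_le_iff₀ (by linarith)]
          nlinarith
    refine le_trans ?_ (div_le_div_of_nonneg_right hmin hx.le)
    have e : N (k + 1) * (12 / 5 / (N (k + 1) * N k)) = 12 / 5 / N k := by
      field_simp
    rw [e, div_div (12 / 5)]
    exact div_le_div_of_nonneg_left (by norm_num) (by positivity) (by linarith)
  · have : ∑ i ∈ Finset.range (H + 1), (d i / N (i + 1) - d i / (N (i + 1) + N (H + 1 + 1)))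
        ≤ 1 / 3 := by
      rw [Finset.sum_range_succ, d0, e1, e2]
      rw [e2] at hT
      norm_num at hT ⊢
      linarith
    refine ⟨this.trans ?_, fun _ => this⟩
    norm_num [d1, d2, e2]
  · refine ⟨?_, by omega⟩
    rw [Finset.sum_range_succ, Finset.sum_range_succ, d0, d1, e1, e2, e3, d2, d3]
    rw [e3] at hT
    norm_num at hT ⊢
    linarith

lemma deviationCost_succ {l k m : ℕ} (hk : k ≤ H + 3) (hl : l ≤ m) (hm : m < H + 3) :
    deviationCost d N l k (m + 1) = deviationCost d N l k m +
      (d (m + 1) - d m * N (m + 1) / (N (m + 1) + N k)) / N k := by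
  have hx := B.N_pos hk
  have hy := B.N_pos (i := m + 1) hm
  rw [deviationCost, deviationCost, Finset.sum_Ico_succ_top hl]
  field_simp
  ring

lemma deviationCost_anti {l m p : ℕ} (hp : p + 1 ≤ H + 3) (hl : l ≤ m) (hmp : m ≤ p) :
    deviationCost d N l (p + 1) p ≤ deviationCost d N l (p + 1) m := by
  induction hmp using Nat.decreasingInduction with
  | self => exact le_rfl
  | of_succ m hm ih =>
    refine (ih (by omega)).trans ?_
    rw [B.deviationCost_succ hp hl (by omega)]
    have hx := B.N_pos hp
    have hy := B.N_pos (i := m + 1) (by omega)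
    have h1 : (1 : ℝ) + d (m + 1) * N (p + 1) ≤ N (m + 1) := by
      rw [B.N_rec (m + 1) (by omega)]
      have := B.N_anti (i := m + 1 + 1) (j := p + 1) (by omega) hp
      have := B.d_nonneg (i := m + 1) (by omega)
      gcongr
    have h2 := B.succ_add_one_le m (by omega)
    have h3 : (1:ℝ) ≤ d (m + 1) := B.one_le_d (by omega)
    have : d (m + 1) ≤ d m * N (m + 1) / (N (m + 1) + N (p + 1)) := by
      rw [le_div_iff₀ (by positivity)]
      nlinarith
    have : (d (m + 1) - d m * N (m + 1) / (N (m + 1) + N (p + 1))) / N (p + 1) ≤ 0 :=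
      div_nonpos_of_nonpos_of_nonneg (by linarith) hx.le
    linarith

lemma deviationCost_mono {l k m : ℕ} (hl : l ≤ k) (hkm : k ≤ m) (hm : m ≤ H + 2) :
    deviationCost d N l k k ≤ deviationCost d N l k m := by
  induction m, hkm using Nat.le_induction with
  | base => exact le_rfl
  | succ m hkm ih =>
    refine (ih (by omega)).trans ?_
    rw [B.deviationCost_succ (by omega) (by omega) (by omega)]
    have hx := B.N_pos (i := k) (by omega)
    have hy := B.N_pos (i := m + 1) (by omega)
    have h1 := B.one_le_d (i := m + 1) (by omega)
    have h2 := B.N_anti hkm (by omega)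
    have h3 := B.N_rec m (by omega)
    have : d m * N (m + 1) / (N (m + 1) + N k) ≤ 1 := by
      rw [div_le_one (by positivity)]; linarith
    have : 0 ≤ (d (m + 1) - d m * N (m + 1) / (N (m + 1) + N k)) / N k :=
      div_nonneg (by linarith) hx.le
    linarith

lemma deviationCost_le_leaf {l k : ℕ} (hl : l ≤ k) (hk : k ≤ H + 1) :
    deviationCost d N l k k ≤ deviationCost d N l k (H + 3) := by
  refine (B.deviationCost_mono hl hk (by omega)).trans ?_
  rw [B.deviationCost_succ (m := H + 2) (by omega) (by omega) (by omega),
    B.deviationCost_succ (m := H + 1) (by omega) (by omega) (by omega), add_assoc,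
    B.d_add_three, B.d_add_two, B.d_add_one, B.N_add_three, B.N_add_two]
  have hx : 5 ≤ N k := B.N_add_one ▸ B.N_anti hk (by omega)
  refine le_add_of_nonneg_right ?_
  rw [← add_div]
  refine div_nonneg ?_ (by linarith)
  have h1 : 2 * 2 / (2 + N k) ≤ 4 / 7 := by
    rw [div_le_div_iff₀ (by linarith) (by norm_num)]; linarith
  have h2 : 1 * 1 / (1 + N k) ≤ 1 / 6 := by
    rw [div_le_div_iff₀ (by linarith) (by norm_num)]; linarith
  linarith

/-- No gain from attaching to a node outside the subtree of one's parent, or to an ancestor. -/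
lemma path_cost_le {l k m : ℕ} (hlk : l + 1 < k) (hk : k ≤ H + 3) (hl : l ≤ m) (hm : m ≤ H + 3) :
    ∑ i ∈ Finset.Ico l k, d i / N (i + 1)
      ≤ (d m + 1) / N k + ∑ i ∈ Finset.Ico l m, d i / (N (i + 1) + N k) := by
  obtain ⟨p, rfl⟩ : ∃ p, k = p + 1 := ⟨k - 1, by omega⟩
  have hx := B.N_pos hk
  obtain ⟨hS, hS'⟩ := B.total_saving_le hk
  have hlow : ∀ C, ∑ i ∈ Finset.range p, (d i / N (i + 1) - d i / (N (i + 1) + N (p + 1))) ≤ C →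
      ∑ i ∈ Finset.Ico l (p + 1), d i / N (i + 1)
        ≤ C + deviationCost d N l (p + 1) p := by
    intro C hC
    rw [deviationCost, Finset.sum_Ico_succ_top (by omega)]
    have : ∑ i ∈ Finset.Ico l p, (d i / N (i + 1) - d i / (N (i + 1) + N (p + 1))) ≤ C := by
      refine le_trans (Finset.sum_le_sum_of_subset_of_nonneg ?_ ?_) hC
      · intro i hi
        simp only [Finset.mem_Ico, Finset.mem_range] at hi ⊢
        omega
      · intro i hi _
        have hi := Finset.mem_range.1 hi
        have := B.N_pos (i := i + 1) (by omega)
        have := B.d_nonneg (i := i) (by omega)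
        rw [sub_nonneg]
        gcongr
        linarith
    rw [Finset.sum_sub_distrib] at this
    linarith
  have hgoal : (d m + 1) / N (p + 1) + ∑ i ∈ Finset.Ico l m, d i / (N (i + 1) + N (p + 1))
      = 1 / N (p + 1) + deviationCost d N l (p + 1) m := by
    rw [deviationCost]; ring
  have hk1 : deviationCost d N l (p + 1) (p + 1) = deviationCost d N l (p + 1) p +
      (d (p + 1) - d p / 2) / N (p + 1) := by
    rw [B.deviationCost_succ hk (by omega) (by omega)]
    congr 2
    field_simp
    ring
  rw [hgoal]
  have hself : ∑ i ∈ Finset.Ico l (p + 1), d i / N (i + 1)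
      ≤ 1 / N (p + 1) + deviationCost d N l (p + 1) (p + 1) := by
    have := hlow _ (hS.trans (div_le_div_of_nonneg_right (min_le_right _ _) hx.le))
    rw [hk1]
    refine this.trans (le_of_eq ?_)
    ring
  obtain hmp | hmp := le_or_gt m p
  · have h1 := hlow _ (hS.trans (div_le_div_of_nonneg_right (min_le_left _ _) hx.le))
    exact h1.trans (by linarith [B.deviationCost_anti hk hl hmp])
  · obtain hm' | rfl : m ≤ H + 2 ∨ m = H + 3 := by omega
    · linarith [B.deviationCost_mono (l := l) (k := p + 1) (by omega) hmp hm']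
    · obtain hp | rfl | rfl : p + 1 ≤ H + 1 ∨ p = H + 1 ∨ p = H + 2 := by omega
      · linarith [B.deviationCost_le_leaf (l := l) (k := p + 1) (by omega) hp]
      · have h1 := hlow _ (hS' rfl)
        have h2 := B.deviationCost_succ (l := l) (k := H + 2) (m := H + 2)
          (by omega) (by omega) (by omega)
        simp only [add_assoc, Nat.reduceAdd, B.d_add_three, B.d_add_two, B.d_add_one,
          B.N_add_three, B.N_add_two] at h1 h2 hk1 ⊢
        norm_num at h1 h2 hk1 ⊢
        linarith
      · exact hself

/-- No gain from attaching to a node in the subtree of a sibling. -/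
lemma sibling_cost_le {l m : ℕ} (hl : l + 1 ≤ m) (hm : m ≤ H + 3) :
    d l / N (l + 1) ≤ (d m + 1) / N (l + 1) +
      (∑ i ∈ Finset.Ico l m, d i / (N (i + 1) + N (l + 1)) - 1 / (2 * N (l + 1))) := by
  have hx := B.N_pos (i := l + 1) (by omega)
  have hgoal : (d m + 1) / N (l + 1) +
      (∑ i ∈ Finset.Ico l m, d i / (N (i + 1) + N (l + 1)) - 1 / (2 * N (l + 1)))
      = 1 / (2 * N (l + 1)) + deviationCost d N l (l + 1) m := by
    rw [deviationCost]; field_simp; ring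
  rw [hgoal]
  have hself : deviationCost d N l (l + 1) (l + 1) = (d (l + 1) + d l / 2) / N (l + 1) := by
    simp only [deviationCost, Nat.Ico_succ_singleton, Finset.sum_singleton]
    field_simp
    ring
  have h1 : d l / N (l + 1) ≤ 1 / (2 * N (l + 1)) + deviationCost d N l (l + 1) (l + 1) := by
    rw [hself, ← sub_nonneg]
    have := B.le_two_mul l (by omega)
    have e : 1 / (2 * N (l + 1)) + (d (l + 1) + d l / 2) / N (l + 1) - d l / N (l + 1)
        = (1 / 2 + d (l + 1) - d l / 2) / N (l + 1) := by
      field_simp; ring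
    rw [e]
    exact div_nonneg (by linarith) hx.le
  obtain hm' | rfl : m ≤ H + 2 ∨ m = H + 3 := by omega
  · linarith [B.deviationCost_mono (l := l) (k := l + 1) (by omega) hl hm']
  · obtain hp | rfl | rfl : l + 1 ≤ H + 1 ∨ l = H + 1 ∨ l = H + 2 := by omega
    · linarith [B.deviationCost_le_leaf (l := l) (k := l + 1) (by omega) hp]
    · have h2 := B.deviationCost_succ (l := H + 1) (k := H + 2) (m := H + 2)
        (by omega) (by omega) (by omega)
      simp only [add_assoc, Nat.reduceAdd, B.d_add_three, B.d_add_two, B.d_add_one,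
        B.N_add_three, B.N_add_two] at h2 hself ⊢
      norm_num at h2 hself ⊢
      linarith
    · exact h1

lemma sqDegSum_add_le {i : ℕ} (hi : i ≤ H + 1) :
    sqDegSum (H + 3) d (i + 2) + 2 * d (H + 1 - i) + 4 ≤ 283 / 100 * N (H + 1 - i) := by
  induction i with
  | zero =>
    have h1 : H + 3 - (0 + 1) = H + 2 := rfl
    have h2 : H + 3 - (1 + 1) = H + 1 := rfl
    simp only [sqDegSum, h1, h2, B.d_add_one, B.d_add_two, Nat.sub_zero, B.N_add_one]
    norm_num
  | succ i ih =>
    have ih := ih (by omega)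
    have e1 : H + 3 - (i + 2 + 1) = H - i := by omega
    have e2 : H + 1 - (i + 1) = H - i := by omega
    have e3 : H + 1 - i = (H - i) + 1 := by omega
    rw [show i + 1 + 2 = i + 2 + 1 from rfl, sqDegSum, e1, e2, B.N_rec (H - i) (by omega)]
    rw [e3] at ih
    have h1 := B.le_two_mul (H - i) (by omega)
    have h2 := B.four_le_d (i := H - i) (by omega)
    nlinarith

lemma sqDegSum_le : sqDegSum (H + 3) d (H + 3) ≤ 283 / 100 * (N 0 - 1) := by
  have h1 := B.sqDegSum_add_le (i := H + 1) le_rfl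
  rw [Nat.sub_self] at h1
  have h2 : sqDegSum (H + 3) d (H + 3) = sqDegSum (H + 3) d (H + 1 + 2) := rfl
  linarith [B.d_nonneg (i := 0) (by omega)]

end BalancedSeq
lemma cost_self (r : Fin (n + 1)) (s : Fin (n + 1) → Fin (n + 1)) : cost r s r = 0 := by
  have h : ∃ k, s^[k] r = r := ⟨0, rfl⟩
  have h0 : Nat.find h = 0 := (Nat.find_eq_zero h).2 rfl
  rw [cost, dif_pos h, h0, Finset.sum_range_zero]

lemma cost_of_ne {r v : Fin (n + 1)} (s : Fin (n + 1) → Fin (n + 1)) (hv : v ≠ r) :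
    cost r s v = (indeg r s (s v) : ℝ≥0∞) / (subtreeSize s v : ℝ≥0∞) + cost r s (s v) := by
  by_cases h : ∃ k, s^[k] (s v) = r
  · have h' : ∃ k, s^[k] v = r := h.imp' Nat.succ fun k hk => hk
    have hf : Nat.find h' = Nat.find h + 1 := Nat.find_comp_succ h' h hv
    rw [cost, cost, dif_pos h, dif_pos h', hf, Finset.sum_range_succ', add_comm]
    rfl
  · have h' : ¬∃ k, s^[k] v = r := by
      rintro ⟨_ | k, hk⟩
      · exact hv hk
      · exact h ⟨k, hk⟩
    rw [cost, cost, dif_neg h, dif_neg h', add_top]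

/-- The nodes having a directed path to `u`. -/
def subtree (s : Fin (n + 1) → Fin (n + 1)) (u : Fin (n + 1)) : Finset (Fin (n + 1)) :=
  Finset.univ.filter fun w => ∃ k, s^[k] w = u

/-- The agents whose edge points to `v`. -/
def children (s : Fin (n + 1) → Fin (n + 1)) (v : Fin (n + 1)) : Finset (Fin (n + 1)) :=
  Finset.univ.filter fun u => u ≠ 0 ∧ s u = v

lemma mem_subtree {s : Fin (n + 1) → Fin (n + 1)} {u w : Fin (n + 1)} :
    w ∈ subtree s u ↔ ∃ k, s^[k] w = u := by
  simp [subtree]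

lemma mem_children {s : Fin (n + 1) → Fin (n + 1)} {u v : Fin (n + 1)} :
    u ∈ children s v ↔ u ≠ 0 ∧ s u = v := by
  simp [children]

lemma self_mem_subtree (s : Fin (n + 1) → Fin (n + 1)) (u : Fin (n + 1)) : u ∈ subtree s u :=
  mem_subtree.2 ⟨0, rfl⟩

lemma subtreeSize_eq_card (s : Fin (n + 1) → Fin (n + 1)) (u : Fin (n + 1)) :
    subtreeSize s u = (subtree s u).card :=
  Nat.subtype_card _ fun _ => mem_subtree

lemma indeg_eq_card (s : Fin (n + 1) → Fin (n + 1)) (v : Fin (n + 1)) :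
    indeg 0 s v = (children s v).card :=
  Nat.subtype_card _ fun _ => mem_children

lemma subtreeSize_pos (s : Fin (n + 1) → Fin (n + 1)) (u : Fin (n + 1)) :
    0 < subtreeSize s u := by
  rw [subtreeSize_eq_card]
  exact Finset.card_pos.2 ⟨u, self_mem_subtree s u⟩

lemma mem_subtree_of_map_mem {s : Fin (n + 1) → Fin (n + 1)} {u w : Fin (n + 1)}
    (h : s w ∈ subtree s u) : w ∈ subtree s u := by
  obtain ⟨k, hk⟩ := mem_subtree.1 h
  exact mem_subtree.2 ⟨k + 1, hk⟩

lemma subtree_subset {s : Fin (n + 1) → Fin (n + 1)} {u v : Fin (n + 1)}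
    (h : v ∈ subtree s u) : subtree s v ⊆ subtree s u := by
  intro w hw
  obtain ⟨j, rfl⟩ := mem_subtree.1 h
  obtain ⟨k, rfl⟩ := mem_subtree.1 hw
  exact mem_subtree.2 ⟨j + k, Function.iterate_add_apply s j k w⟩

section Deviation

variable {s : Fin (n + 1) → Fin (n + 1)} {v w : Fin (n + 1)}

lemma subtree_update_subset (u : Fin (n + 1)) :
    subtree (update s v w) u ⊆ subtree s u ∪ subtree s v := by
  intro x hx
  obtain ⟨k, hk⟩ := mem_subtree.1 hx
  clear hx
  induction k generalizing x with
  | zero =>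
    obtain rfl : x = u := hk
    exact Finset.mem_union_left _ (self_mem_subtree s x)
  | succ k ih =>
    by_cases hx : x = v
    · exact Finset.mem_union_right _ (hx ▸ self_mem_subtree s v)
    · rw [iterate_succ_apply, update_of_ne hx] at hk
      exact (Finset.mem_union.1 (ih hk)).elim
        (fun h => Finset.mem_union_left _ (mem_subtree_of_map_mem h))
        fun h => Finset.mem_union_right _ (mem_subtree_of_map_mem h)

lemma subtreeSize_update_le (u : Fin (n + 1)) :
    subtreeSize (update s v w) u ≤ subtreeSize s u + subtreeSize s v := by
  simp only [subtreeSize_eq_card]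
  exact (Finset.card_le_card (subtree_update_subset u)).trans (Finset.card_union_le _ _)

lemma subtreeSize_update_le_of_mem {u : Fin (n + 1)} (h : v ∈ subtree s u) :
    subtreeSize (update s v w) u ≤ subtreeSize s u := by
  simp only [subtreeSize_eq_card]
  refine Finset.card_le_card ((subtree_update_subset u).trans ?_)
  exact Finset.union_subset le_rfl (subtree_subset h)

lemma indeg_le_update {x : Fin (n + 1)} (hx : x ≠ s v) :
    indeg 0 s x ≤ indeg 0 (update s v w) x := by
  simp only [indeg_eq_card]
  refine Finset.card_le_card fun u hu => ?_
  obtain ⟨h0, rfl⟩ := mem_children.1 hu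
  exact mem_children.2 ⟨h0, update_of_ne (fun h => hx (congrArg s h)) _ _⟩

lemma indeg_le_update_add_one (x : Fin (n + 1)) :
    indeg 0 s x ≤ indeg 0 (update s v w) x + 1 := by
  simp only [indeg_eq_card]
  refine (Finset.card_le_card (t := insert v (children (update s v w) x)) fun u hu => ?_).trans
    (Finset.card_insert_le _ _)
  obtain ⟨h0, rfl⟩ := mem_children.1 hu
  rw [Finset.mem_insert, or_iff_not_imp_left]
  exact fun h => mem_children.2 ⟨h0, update_of_ne h _ _⟩

lemma indeg_add_one_le_update (hv : v ≠ 0) (hw : w ≠ s v) :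
    indeg 0 s w + 1 ≤ indeg 0 (update s v w) w := by
  simp only [indeg_eq_card]
  have hn : v ∉ children s w := fun h => hw (mem_children.1 h).2.symm
  rw [← Finset.card_insert_of_notMem hn]
  refine Finset.card_le_card fun u hu => ?_
  by_cases huv : u = v
  · subst huv
    exact mem_children.2 ⟨hv, update_self _ _ _⟩
  · obtain ⟨h0, hs⟩ := mem_children.1 ((Finset.mem_insert.1 hu).resolve_left huv)
    exact mem_children.2 ⟨h0, by rw [update_of_ne huv, hs]⟩

lemma cost_update_eq_top (hs : s 0 = 0) (hv : v ≠ 0) (hw : w ∈ subtree s v) :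
    cost 0 (update s v w) v = ⊤ := by
  have key : ∀ (k : ℕ) (x : Fin (n + 1)), s^[k] x = v → ∃ i, (update s v w)^[i] x = v := by
    intro k
    induction k with
    | zero => exact fun x hx => ⟨0, hx⟩
    | succ k ih =>
      intro x hx
      by_cases h : x = v
      · exact ⟨0, h⟩
      · obtain ⟨i, hi⟩ := ih _ hx
        exact ⟨i + 1, by rw [iterate_succ_apply, update_of_ne h, hi]⟩
  obtain ⟨k, hk⟩ := mem_subtree.1 hw
  obtain ⟨i, hi⟩ := key k w hk
  have hp : IsPeriodicPt (update s v w) (i + 1) v := by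
    rw [IsPeriodicPt, IsFixedPt, iterate_succ_apply, update_self, hi]
  refine dif_neg ?_
  rintro ⟨j, hj⟩
  have h1 := (hp.mul_const j).eq
  have h0 : IsFixedPt (update s v w) 0 := by
    rw [IsFixedPt, update_of_ne hv.symm, hs]
  rw [show (i + 1) * j = i * j + j by ring, iterate_add_apply, hj, (h0.iterate _).eq] at h1
  exact hv h1.symm

end Deviation

/-- The network of `s` is a tree of height at most `h` in which `lev` is the distance from the root
and a node at distance `k` has in-degree `d k`. -/
structure IsLeveled (h : ℕ) (d : ℕ → ℕ) (s : Fin (n + 1) → Fin (n + 1))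
    (lev : Fin (n + 1) → ℕ) : Prop where
  map_zero : s 0 = 0
  lev_zero : lev 0 = 0
  lev_of_ne : ∀ v, v ≠ 0 → lev v = lev (s v) + 1
  lev_le : ∀ v, lev v ≤ h
  indeg_eq : ∀ v, indeg 0 s v = d (lev v)

namespace IsLeveled

variable {h : ℕ} {d : ℕ → ℕ} {s : Fin (n + 1) → Fin (n + 1)} {lev : Fin (n + 1) → ℕ}
  (L : IsLeveled h d s lev)
include L

lemma lev_eq_zero {v : Fin (n + 1)} (hv : lev v = 0) : v = 0 := by
  by_contra h0
  rw [L.lev_of_ne v h0] at hv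
  omega

lemma mem_subtree_iff {u w : Fin (n + 1)} :
    w ∈ subtree s u ↔ ∃ k, lev w = lev u + k ∧ s^[k] w = u := by
  refine ⟨fun hw => ?_, fun ⟨k, _, hk⟩ => mem_subtree.2 ⟨k, hk⟩⟩
  obtain ⟨k, hk⟩ := mem_subtree.1 hw
  clear hw
  induction k generalizing w with
  | zero => exact ⟨0, by rw [show w = u from hk]; rfl, hk⟩
  | succ k ih =>
    obtain ⟨j, hj, hj'⟩ := ih hk
    by_cases h0 : w = 0
    · subst h0
      rw [L.map_zero] at hj hj'
      exact ⟨j, hj, hj'⟩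
    · exact ⟨j + 1, by rw [L.lev_of_ne w h0, hj]; rfl, hj'⟩

lemma subtree_eq (v : Fin (n + 1)) :
    subtree s v = insert v ((children s v).biUnion (subtree s)) := by
  ext w
  simp only [Finset.mem_insert, Finset.mem_biUnion]
  constructor
  · intro hw
    obtain ⟨k, hk, hk'⟩ := L.mem_subtree_iff.1 hw
    clear hw
    induction k generalizing w with
    | zero => exact Or.inl hk'
    | succ k ih =>
      have h0 : w ≠ 0 := by
        rintro rfl
        rw [L.lev_zero] at hk
        omega
      have hl := L.lev_of_ne w h0
      obtain h1 | ⟨u, hu, hwu⟩ := ih (s w) (by omega) hk'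
      · exact Or.inr ⟨w, mem_children.2 ⟨h0, h1⟩, self_mem_subtree s w⟩
      · exact Or.inr ⟨u, hu, mem_subtree_of_map_mem hwu⟩
  · rintro (rfl | ⟨u, hu, hw⟩)
    · exact self_mem_subtree s w
    · refine subtree_subset ?_ hw
      exact mem_subtree.2 ⟨1, (mem_children.1 hu).2⟩

lemma lev_of_mem_children {u v : Fin (n + 1)} (hu : u ∈ children s v) :
    lev u = lev v + 1 := by
  obtain ⟨h0, rfl⟩ := mem_children.1 hu
  exact L.lev_of_ne u h0

lemma eq_of_mem_subtree {u v : Fin (n + 1)} (hl : lev u = lev v) (hu : u ∈ subtree s v) :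
    u = v := by
  obtain ⟨k, hk, hk'⟩ := L.mem_subtree_iff.1 hu
  obtain rfl : k = 0 := by omega
  exact hk'

lemma sum_subtree {φ Φ : ℕ → ℝ} (hΦ : ∀ k < h, Φ k = φ k + d k * Φ (k + 1))
    (hh : Φ h = φ h) (hd : d h = 0) (v : Fin (n + 1)) :
    ∑ w ∈ subtree s v, φ (lev w) = Φ (lev v) := by
  obtain ⟨j, hj⟩ : ∃ j, lev v + j = h := ⟨h - lev v, by have := L.lev_le v; omega⟩
  induction j generalizing v with
  | zero =>
    have hc : children s v = ∅ := by
      rw [← Finset.card_eq_zero, ← indeg_eq_card, L.indeg_eq, show lev v = h from hj, hd]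
    rw [L.subtree_eq, hc, Finset.biUnion_empty, insert_empty_eq, Finset.sum_singleton,
      show lev v = h from hj, hh]
  | succ j ih =>
    rw [L.subtree_eq, Finset.sum_insert, Finset.sum_biUnion]
    · rw [Finset.sum_congr rfl fun u hu => (ih u (by rw [L.lev_of_mem_children hu]; omega)).trans
        (congrArg Φ (L.lev_of_mem_children hu)), Finset.sum_const, ← indeg_eq_card, L.indeg_eq,
        nsmul_eq_mul, hΦ (lev v) (by omega)]
    · intro u hu u' hu' hne
      refine Finset.disjoint_left.2 fun w hw hw' => hne ?_
      obtain ⟨a, ha, rfl⟩ := L.mem_subtree_iff.1 hw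
      obtain ⟨b, hb, rfl⟩ := L.mem_subtree_iff.1 hw'
      have h1 := L.lev_of_mem_children hu
      have h2 := L.lev_of_mem_children hu'
      obtain rfl : a = b := by omega
      rfl
    · rw [Finset.mem_biUnion]
      rintro ⟨u, hu, hv⟩
      obtain ⟨k, hk, -⟩ := L.mem_subtree_iff.1 hv
      have := L.lev_of_mem_children hu
      omega

lemma subtree_zero : subtree s 0 = Finset.univ := by
  refine Finset.eq_univ_of_forall fun w => mem_subtree.2 ?_
  induction hk : lev w generalizing w with
  | zero => exact ⟨0, L.lev_eq_zero hk⟩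
  | succ k ih =>
    have h0 : w ≠ 0 := by
      rintro rfl
      rw [L.lev_zero] at hk
      omega
    have := L.lev_of_ne w h0
    obtain ⟨j, hj⟩ := ih (s w) (by omega)
    exact ⟨j + 1, hj⟩

end IsLeveled

lemma ofReal_div_le {a b : ℕ} {x y : ℝ} (hx : x ≤ a) (hb : 0 < b) (hy : b ≤ y) :
    ENNReal.ofReal (x / y) ≤ (a : ℝ≥0∞) / (b : ℝ≥0∞) := by
  have hb' : (0 : ℝ) < b := Nat.cast_pos.2 hb
  rw [← ENNReal.ofReal_natCast a, ← ENNReal.ofReal_natCast b, ← ENNReal.ofReal_div_of_pos hb']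
  refine ENNReal.ofReal_le_ofReal ?_
  calc x / y ≤ a / y := div_le_div_of_nonneg_right hx (hb'.le.trans hy)
    _ ≤ a / b := div_le_div_of_nonneg_left (Nat.cast_nonneg a) hb' hy

section Balanced

variable {H : ℕ} {d : ℕ → ℕ} {N : ℕ → ℝ} {s : Fin (n + 1) → Fin (n + 1)}
  {lev : Fin (n + 1) → ℕ} (L : IsLeveled (H + 3) d s lev) (B : BalancedSeq H (fun k => d k) N)
include L B

lemma subtreeSize_eq (v : Fin (n + 1)) : (subtreeSize s v : ℝ) = N (lev v) := by
  have := L.sum_subtree (φ := fun _ => 1) B.N_rec B.N_add_three (by exact_mod_cast B.d_add_three) v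
  rw [← this, subtreeSize_eq_card, Finset.sum_const, nsmul_eq_mul, mul_one]

lemma cost_eq (v : Fin (n + 1)) :
    cost 0 s v = ENNReal.ofReal (levelCost (fun k => d k) N (lev v)) := by
  induction hk : lev v generalizing v with
  | zero =>
    obtain rfl := L.lev_eq_zero hk
    simp [cost_self, levelCost]
  | succ k ih =>
    have h0 : v ≠ 0 := by
      rintro rfl
      rw [L.lev_zero] at hk
      omega
    have h1 : lev (s v) = k := by have := L.lev_of_ne v h0; omega
    have h2 := L.lev_le v
    have h3 := B.N_pos (i := k + 1) (by omega)
    have h4 := subtreeSize_eq L B v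
    have h5 := B.levelCost_nonneg (k := k) (by omega)
    rw [levelCost] at h5
    rw [cost_of_ne s h0, ih _ h1, L.indeg_eq, h1, levelCost, levelCost, Finset.sum_range_succ,
      ENNReal.ofReal_add h5 (by positivity), add_comm, ENNReal.ofReal_div_of_pos h3,
      ENNReal.ofReal_natCast, ← hk, ← h4, ENNReal.ofReal_natCast]

lemma le_cost_update_of_mem {v w u : Fin (n + 1)} (hv : v ≠ 0) (hu : v ∈ subtree s u)
    (huv : u ≠ v) :
    ENNReal.ofReal (levelCost (fun k => d k) N (lev u)) ≤ cost 0 (update s v w) u := by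
  induction hk : lev u generalizing u with
  | zero => simp [levelCost]
  | succ k ih =>
    have h0 : u ≠ 0 := by
      rintro rfl
      rw [L.lev_zero] at hk
      omega
    have hl := L.lev_of_ne u h0
    obtain ⟨j, hj, -⟩ := L.mem_subtree_iff.1 hu
    have hsu : s u ≠ v := by
      rintro h
      rw [h] at hl
      omega
    have hsuv : s u ≠ s v := fun h =>
      huv (L.eq_of_mem_subtree (by rw [hl, L.lev_of_ne v hv, h]) hu).symm
    have hmem : v ∈ subtree s (s u) :=
      subtree_subset (mem_subtree.2 ⟨1, rfl⟩) hu
    have hsize : ((subtreeSize (update s v w) u : ℕ) : ℝ) ≤ N (k + 1) := by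
      rw [← hk, ← subtreeSize_eq L B u]
      exact_mod_cast subtreeSize_update_le_of_mem hu
    have hdeg : (d k : ℝ) ≤ (indeg 0 (update s v w) (s u) : ℕ) := by
      have := indeg_le_update (w := w) hsuv
      rw [L.indeg_eq, show lev (s u) = k by omega] at this
      exact_mod_cast this
    rw [cost_of_ne _ h0, update_of_ne huv, levelCost, Finset.sum_range_succ, add_comm]
    refine ENNReal.ofReal_add_le.trans (add_le_add ?_ (ih hmem hsu (by omega)))
    exact ofReal_div_le hdeg (subtreeSize_pos _ _) hsize

lemma exists_le_cost_update {v w u : Fin (n + 1)} (hv : v ≠ 0) (hu : v ∉ subtree s u)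
    (huv : u ∉ subtree s v) :
    ∃ l, l < lev u ∧ l + 1 ≤ lev v ∧
      ENNReal.ofReal (levelCost (fun k => d k) N l +
        (∑ i ∈ Finset.Ico l (lev u), d i / (N (i + 1) + N (lev v)) -
          if l + 1 = lev v then 1 / (2 * N (lev v)) else 0)) ≤ cost 0 (update s v w) u := by
  induction hk : lev u generalizing u with
  | zero =>
    obtain rfl := L.lev_eq_zero hk
    exact absurd (L.subtree_zero ▸ Finset.mem_univ v) hu
  | succ k ih =>
    have h0 : u ≠ 0 := by
      rintro rfl
      rw [L.lev_zero] at hk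
      omega
    have hl := L.lev_of_ne u h0
    have hne : u ≠ v := fun h => huv (h ▸ self_mem_subtree s u)
    have hsu : s u ∉ subtree s v := fun h => huv (mem_subtree_of_map_mem h)
    have hsize : ((subtreeSize (update s v w) u : ℕ) : ℝ) ≤ N (k + 1) + N (lev v) := by
      rw [← hk, ← subtreeSize_eq L B u, ← subtreeSize_eq L B v]
      exact_mod_cast subtreeSize_update_le u
    have hdeg : s u ≠ s v → (d k : ℝ) ≤ (indeg 0 (update s v w) (s u) : ℕ) := by
      intro h
      have := indeg_le_update (w := w) h
      rw [L.indeg_eq, show lev (s u) = k by omega] at this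
      exact_mod_cast this
    rw [cost_of_ne _ h0, update_of_ne hne]
    by_cases hmem : v ∈ subtree s (s u)
    · have hsuv : s u ≠ v := fun h => hsu (h ▸ self_mem_subtree s (s u))
      have hlv : lev (s u) < lev v := by
        obtain ⟨j, hj, hj'⟩ := L.mem_subtree_iff.1 hmem
        have : j ≠ 0 := by
          rintro rfl
          exact hsuv hj'.symm
        omega
      have hA := le_cost_update_of_mem L B (w := w) hv hmem hsuv
      rw [show lev (s u) = k by omega] at hA
      refine ⟨k, by omega, by omega, ?_⟩
      rw [add_comm]
      refine ENNReal.ofReal_add_le.trans (add_le_add ?_ hA)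
      rw [Nat.Ico_succ_singleton, Finset.sum_singleton]
      split_ifs with hc
      · have e : d k / (N (k + 1) + N (lev v)) - 1 / (2 * N (lev v))
            = (d k - 1) / (N (k + 1) + N (lev v)) := by
          rw [hc, ← two_mul, sub_div]
        rw [e]
        refine ofReal_div_le ?_ (subtreeSize_pos _ _) hsize
        have := indeg_le_update_add_one (s := s) (v := v) (w := w) (s u)
        rw [L.indeg_eq, show lev (s u) = k by omega] at this
        rw [sub_le_iff_le_add]
        exact_mod_cast this
      · rw [sub_zero]
        refine ofReal_div_le (hdeg fun h => hc ?_) (subtreeSize_pos _ _) hsize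
        have := L.lev_of_ne v hv
        rw [← h] at this
        omega
    · obtain ⟨l, hlk, hlv, hle⟩ := ih hmem hsu (by omega)
      refine ⟨l, by omega, hlv, ?_⟩
      rw [Finset.sum_Ico_succ_top hlk.le, add_sub_right_comm, ← add_assoc, add_comm]
      refine ENNReal.ofReal_add_le.trans (add_le_add ?_ hle)
      refine ofReal_div_le (hdeg fun h => hmem ?_) (subtreeSize_pos _ _) hsize
      exact h ▸ mem_subtree.2 ⟨1, rfl⟩

lemma cost_le_cost_update {v : Fin (n + 1)} (hv : v ≠ 0) (w : Fin (n + 1)) :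
    cost 0 s v ≤ cost 0 (update s v w) v := by
  by_cases hw : w = s v
  · rw [hw, update_eq_self]
  by_cases hwv : w ∈ subtree s v
  · rw [cost_update_eq_top L.map_zero hv hwv]
    exact le_top
  have hne : w ≠ v := fun h => hwv (h ▸ self_mem_subtree s w)
  have hedge : ENNReal.ofReal ((d (lev w) + 1) / N (lev v)) ≤
      (indeg 0 (update s v w) w : ℝ≥0∞) / (subtreeSize (update s v w) v : ℝ≥0∞) := by
    refine ofReal_div_le ?_ (subtreeSize_pos _ _) ?_
    · rw [← L.indeg_eq]
      exact_mod_cast indeg_add_one_le_update hv hw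
    · rw [← subtreeSize_eq L B v]
      exact_mod_cast subtreeSize_update_le_of_mem (self_mem_subtree s v)
  have hsplit : ∀ l ≤ lev v, levelCost (fun k => d k) N (lev v) =
      levelCost (fun k => d k) N l + ∑ i ∈ Finset.Ico l (lev v), (d i : ℝ) / N (i + 1) := by
    intro l hl
    rw [levelCost, levelCost, Finset.range_eq_Ico, Finset.range_eq_Ico,
      Finset.sum_Ico_consecutive _ (Nat.zero_le l) hl]
  rw [cost_of_ne (update s v w) hv, update_self, cost_eq L B v]
  by_cases hmem : v ∈ subtree s w
  · refine le_trans ?_ (add_le_add hedge (le_cost_update_of_mem L B hv hmem hne))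
    have hlt : lev w + 1 < lev v := by
      obtain ⟨j, hj, hj'⟩ := L.mem_subtree_iff.1 hmem
      obtain _ | _ | j := j
      · exact absurd hj'.symm hne
      · exact absurd hj'.symm hw
      · omega
    have hN := B.N_pos (L.lev_le v)
    rw [← ENNReal.ofReal_add (by positivity) (B.levelCost_nonneg (L.lev_le w))]
    refine ENNReal.ofReal_le_ofReal ?_
    have := B.path_cost_le hlt (L.lev_le v) le_rfl (L.lev_le w)
    rw [Finset.Ico_self, Finset.sum_empty] at this
    rw [hsplit (lev w) (by omega)]
    linarith
  · obtain ⟨l, hlw, hlv, hle⟩ := exists_le_cost_update L B (w := w) hv hmem hwv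
    refine le_trans ?_ (add_le_add hedge hle)
    refine le_trans (ENNReal.ofReal_le_ofReal ?_) ENNReal.ofReal_add_le
    rw [hsplit l (by omega)]
    split_ifs with hc
    · have := B.sibling_cost_le (l := l) hlw (L.lev_le w)
      rw [← hc, Nat.Ico_succ_singleton, Finset.sum_singleton]
      linarith
    · have := B.path_cost_le (l := l) (k := lev v) (by omega) (L.lev_le v) hlw.le (L.lev_le w)
      linarith

lemma SC_le : SC s ≤ ENNReal.ofReal 2.83 * (n : ℝ≥0∞) := by
  have hd : d (H + 3) = 0 := by exact_mod_cast B.d_add_three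
  have hn : (n : ℝ) = N 0 - 1 := by
    have := subtreeSize_eq L B 0
    rw [L.lev_zero, subtreeSize_eq_card, L.subtree_zero, Finset.card_univ, Fintype.card_fin] at this
    push_cast at this
    linarith
  have hsum := L.sum_subtree (φ := levelCost (fun k => d k) N)
    (Φ := fun k => N k * levelCost (fun k => d k) N k +
      sqDegSum (H + 3) (fun k => d k) (H + 3 - k)) (fun k hk => ?_) ?_ hd 0
  · rw [L.subtree_zero, L.lev_zero] at hsum
    have hSC : SC s = ENNReal.ofReal (∑ v, levelCost (fun k => d k) N (lev v)) := by
      rw [ENNReal.ofReal_sum_of_nonneg fun v _ => B.levelCost_nonneg (L.lev_le v), SC,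
        Finset.sum_erase _ (cost_self 0 s)]
      exact Finset.sum_congr rfl fun v _ => cost_eq L B v
    rw [hSC, hsum, ← ENNReal.ofReal_natCast n, ← ENNReal.ofReal_mul (by norm_num)]
    refine ENNReal.ofReal_le_ofReal ?_
    have := B.sqDegSum_le
    rw [hn]
    simp only [levelCost, Finset.range_zero, Finset.sum_empty, mul_zero, zero_add, Nat.sub_zero]
    linarith
  · have hN := B.N_pos (i := k + 1) (by omega)
    have e : H + 3 - k = (H + 3 - (k + 1)) + 1 := by omega
    have e' : H + 3 - (H + 3 - (k + 1) + 1) = k := by omega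
    rw [e, sqDegSum, e', B.N_rec k hk, levelCost, levelCost, Finset.sum_range_succ]
    field_simp
    ring
  · simp [B.N_add_three, sqDegSum]

end Balanced

/-- The subtree sizes determined by a degree sequence, by levels counted from the leaves. -/
def leafSize (h : ℕ) (d : ℕ → ℕ) : ℕ → ℝ
  | 0 => 1
  | i + 1 => 1 + d (h - (i + 1)) * leafSize h d i

lemma balancedSeq_leafSize {H : ℕ} {d : ℕ → ℕ} (h0 : d (H + 3) = 0) (h1 : d (H + 2) = 1)
    (h2 : d (H + 1) = 2) (h3 : d H = 4)
    (hseq : ∀ i < H, d (i + 1) < d i ∧ d i ≤ 2 * d (i + 1) + 1) :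
    BalancedSeq H (fun k => d k) fun k => leafSize (H + 3) d (H + 3 - k) := by
  have hall : ∀ i < H + 3, d (i + 1) + 1 ≤ d i ∧ d i ≤ 2 * d (i + 1) + 1 := by
    intro i hi
    obtain hi | rfl | rfl | rfl : i < H ∨ i = H ∨ i = H + 1 ∨ i = H + 2 := by omega
    · exact hseq i hi
    · rw [h2, h3]; omega
    · rw [h1, h2]; omega
    · rw [h0, h1]; omega
  refine ⟨by simp [h0], by simp [h1], by simp [h2], by simp [h3], fun i hi => ?_, fun i hi => ?_,
    by simp [leafSize], fun i hi => ?_⟩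
  · exact_mod_cast (hall i hi).1
  · exact_mod_cast (hall i hi).2
  · have e : H + 3 - i = (H + 3 - (i + 1)) + 1 := by omega
    have e' : H + 3 - (H + 3 - (i + 1) + 1) = i := by omega
    simp only [e, leafSize, e']

/-- If there exists a balanced tree `T` with `n` agents, of height `h`,
with degree sequence `(0, 1, 2, 4, d_{h−4}, …, d_0)` satisfying
`d_{i+1} < d_i ≤ 2·d_{i+1} + 1` for every `i ≤ h − 4`, then `T` is stable and
`SC(T) ≤ 2.83 · n`; in particular, for all such `n` the Price of Stability is at
most `2.83`. -/
theorem price_of_stability_upper_bound {n : ℕ} (h : ℕ) (d : ℕ → ℕ)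
    (s : Fin (n + 1) → Fin (n + 1))
    (hvalid : ValidProfile 0 s) (htree : ∀ v, ∃ k, s^[k] v = 0)
    (hheight : height s = h)
    (hbal : ∀ (v : Fin (n + 1)) (k : ℕ), s^[k] v = 0 → (∀ j < k, s^[j] v ≠ 0) →
      indeg 0 s v = d k)
    (hdh : d h = 0) (hd1 : d (h - 1) = 1) (hd2 : d (h - 2) = 2) (hd3 : d (h - 3) = 4)
    (hseq : ∀ i, i ≤ h - 4 → d (i + 1) < d i ∧ d i ≤ 2 * d (i + 1) + 1) :
    IsStable 0 s ∧ SC s ≤ ENNReal.ofReal 2.83 * (n : ℝ≥0∞) := by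
  have h3 : 3 ≤ h := by
    by_contra hlt
    obtain rfl | rfl | rfl : h = 0 ∨ h = 1 ∨ h = 2 := by omega
    all_goals simp_all
  obtain ⟨H, rfl⟩ := Nat.exists_eq_add_of_le' h3
  have hlev : ∀ v : Fin (n + 1), s^[H + 3] v = 0 := by
    have hbig : ∃ k, ∀ v : Fin (n + 1), s^[k] v = 0 := by
      choose f hf using htree
      refine ⟨∑ v, f v, fun v => ?_⟩
      obtain ⟨j, hj⟩ := Nat.exists_eq_add_of_le'
        (Finset.single_le_sum (f := f) (fun _ _ => Nat.zero_le _) (Finset.mem_univ v))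
      rw [hj, iterate_add_apply, hf]
      exact (show IsFixedPt s 0 from hvalid.1).iterate j
    have := Nat.sInf_mem (s := {k | ∀ v, s^[k] v = 0}) hbig
    rwa [← height, hheight] at this
  have L : IsLeveled (H + 3) d s fun v => Nat.find (htree v) := by
    refine ⟨hvalid.1, (Nat.find_eq_zero _).2 rfl, fun v hv => ?_, fun v => ?_, fun v => ?_⟩
    · exact Nat.find_comp_succ (htree v) (htree (s v)) hv
    · exact Nat.find_min' _ (hlev v)
    · exact hbal v _ (Nat.find_spec (htree v)) fun j hj => Nat.find_min (htree v) hj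
  have B := balancedSeq_leafSize hdh hd1 hd2 hd3 fun i hi => hseq i (by omega)
  exact ⟨⟨hvalid, fun v hv w _ => cost_le_cost_update L B hv w⟩, SC_le L B⟩

end TCG
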